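/- Let A be an invertible N×N real matrix, β > 0, A^{-g} := (Aᵀ A + β I)⁻¹ Aᵀ, b ∈ ℝ^N, and let x₁ := A^{-g} b, x_{k+1} := x_k + A^{-g} (b − A x_k) be the refinement iterates. Then x_k converges to the exact solution A⁻¹ b as k → ∞. -/

import Mathlib

open Matrix

theorem isUnit_det_transpose_mul_self_add_smul_one {n : Type*} [Fintype n] [DecidableEq n]
    (A : Matrix n n ℝ) {β : ℝ} (hβ : 0 < β) :
    IsUnit (Aᵀ * A + β • (1 : Matrix n n ℝ)).det := by
  have hpd : (Aᵀ * A + β • (1 : Matrix n n ℝ)).PosDef := by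
    have h := posSemidef_conjTranspose_mul_self A
    rw [conjTranspose_eq_transpose_of_trivial] at h
    exact PosDef.posSemidef_add h (PosDef.one.smul hβ)
  exact hpd.det_pos.ne'.isUnit

/-- An energy estimate for a step of the implicit iteration `(Aᵀ A + β I) w = β v`. -/
theorem two_mul_dotProduct_mulVec_self_le {n : Type*} [Fintype n] [DecidableEq n]
    (A : Matrix n n ℝ) {β : ℝ} (hβ : 0 < β) {v w : n → ℝ}
    (h : (Aᵀ * A + β • (1 : Matrix n n ℝ)) *ᵥ w = β • v) :
    2 * ((A *ᵥ w) ⬝ᵥ (A *ᵥ w)) ≤ β * (v ⬝ᵥ v - w ⬝ᵥ w) := by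
  have h1 : (A *ᵥ w) ⬝ᵥ (A *ᵥ w) + β * (w ⬝ᵥ w) = β * (w ⬝ᵥ v) := by
    have := congrArg (fun z => w ⬝ᵥ z) h
    simpa [add_mulVec, smul_mulVec, ← mulVec_mulVec, dotProduct_mulVec w Aᵀ,
      vecMul_transpose] using this
  have h2 : 0 ≤ (v - w) ⬝ᵥ (v - w) := by
    simpa using dotProduct_star_self_nonneg (v - w)
  simp only [sub_dotProduct, dotProduct_sub, dotProduct_comm v w] at h2
  nlinarith

theorem tendsto_zero_of_dotProduct_self_tendsto_zero {ι n : Type*} [Fintype n]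
    {l : Filter ι} {f : ι → n → ℝ}
    (h : Filter.Tendsto (fun i => f i ⬝ᵥ f i) l (nhds 0)) : Filter.Tendsto f l (nhds 0) := by
  rw [tendsto_pi_nhds]
  intro j
  have hs : Filter.Tendsto (fun i => √(f i ⬝ᵥ f i)) l (nhds 0) := by
    simpa using h.sqrt
  refine squeeze_zero_norm (fun i => Real.abs_le_sqrt ?_) hs
  rw [sq]
  exact Finset.single_le_sum (f := fun j => f i j * f i j)
    (fun k _ => mul_self_nonneg _) (Finset.mem_univ j)

/-- The implicit iteration `(Aᵀ A + β I) e_{k+1} = β e_k` converges to zero for invertible `A`. -/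
theorem tendsto_zero_of_implicit_iteration {n : Type*} [Fintype n] [DecidableEq n]
    {A : Matrix n n ℝ} (hA : IsUnit A.det) {β : ℝ} (hβ : 0 < β) {e : ℕ → n → ℝ}
    (h : ∀ k, (Aᵀ * A + β • (1 : Matrix n n ℝ)) *ᵥ e (k + 1) = β • e k) :
    Filter.Tendsto e Filter.atTop (nhds 0) := by
  have hnonneg : ∀ v : n → ℝ, 0 ≤ v ⬝ᵥ v := fun v => by
    simpa using dotProduct_star_self_nonneg v
  have hstep := fun k => two_mul_dotProduct_mulVec_self_le A hβ (h k)
  have hanti : Antitone fun k => e k ⬝ᵥ e k := antitone_nat_of_succ_le fun k => by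
    have := hnonneg (A *ᵥ e (k + 1))
    nlinarith [hstep k]
  have hlim := tendsto_atTop_ciInf hanti ⟨0, by rintro _ ⟨k, rfl⟩; exact hnonneg _⟩
  have hdiff := (hlim.sub ((Filter.tendsto_add_atTop_iff_nat 1).2 hlim)).const_mul β
  rw [sub_self, mul_zero] at hdiff
  have henergy : Filter.Tendsto (fun k => (A *ᵥ e (k + 1)) ⬝ᵥ (A *ᵥ e (k + 1)))
      Filter.atTop (nhds 0) :=
    squeeze_zero (fun k => hnonneg _)
      (fun k => by linarith [hstep k, hnonneg (A *ᵥ e (k + 1))]) hdiff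
  have hAe := tendsto_zero_of_dotProduct_self_tendsto_zero henergy
  have hcont : Continuous fun v : n → ℝ => A⁻¹ *ᵥ v := by fun_prop
  have := (hcont.tendsto 0).comp hAe
  rw [← Filter.tendsto_add_atTop_iff_nat 1]
  simpa [Function.comp_def, mulVec_mulVec, nonsing_inv_mul A hA] using this

/-- For `A` invertible and `β > 0`, the refinement iterates
`x₁ = A^{-g} b`, `x_{k+1} = x_k + A^{-g}(b − A x_k)` with
`A^{-g} = (Aᵀ A + β I)⁻¹ Aᵀ` converge to the exact solution `A⁻¹ b` as `k → ∞`. -/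
theorem stmt_12 (N : ℕ) (A : Matrix (Fin N) (Fin N) ℝ) (hA : IsUnit A.det)
    (β : ℝ) (hβ : 0 < β)
    (Ag : Matrix (Fin N) (Fin N) ℝ)
    (hAg : Ag = (Aᵀ * A + β • (1 : Matrix (Fin N) (Fin N) ℝ))⁻¹ * Aᵀ)
    (b : Fin N → ℝ)
    (x : ℕ → Fin N → ℝ)
    (hx1 : x 1 = Ag *ᵥ b)
    (hrec : ∀ k, 1 ≤ k → x (k + 1) = x k + Ag *ᵥ (b - A *ᵥ x k)) :
    Filter.Tendsto x Filter.atTop (nhds (A⁻¹ *ᵥ b)) := by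
  have hM := isUnit_det_transpose_mul_self_add_smul_one A hβ
  have hMAg : (Aᵀ * A + β • (1 : Matrix (Fin N) (Fin N) ℝ)) * Ag = Aᵀ := by
    rw [hAg, mul_nonsing_inv_cancel_left _ _ hM]
  have hb : A *ᵥ (A⁻¹ *ᵥ b) = b := by rw [mulVec_mulVec, mul_nonsing_inv A hA, one_mulVec]
  have herr := tendsto_zero_of_implicit_iteration hA hβ (e := fun k => x (k + 1) - A⁻¹ *ᵥ b)
    fun k => by
      have hres : b - A *ᵥ x (k + 1) = -(A *ᵥ (x (k + 1) - A⁻¹ *ᵥ b)) := by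
        rw [mulVec_sub, hb, neg_sub]
      rw [hrec (k + 1) (by lia), hres, add_sub_right_comm, mulVec_add, mulVec_mulVec, hMAg,
        mulVec_neg, mulVec_mulVec, add_mulVec, smul_mulVec, one_mulVec]
      abel
  rw [← Filter.tendsto_add_atTop_iff_nat 1]
  simpa using herr.add_const (A⁻¹ *ᵥ b)
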